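/- arXiv:1007.0257 — 2 statements merged into one kernel-verified Lean document; each statement's English description precedes it below -/
import Mathlib

section
/- Let m, n be positive integers and let G = C_m ⊕ C_{mn}. Then s_{exp(G)ℕ}(G) = m + 2mn − 2; that is, every sequence over G of length at least m + 2mn − 2 has a nonempty zero-sum subsequence whose length is a (positive) multiple of mn = exp(G), and there exists a sequence over G of length m + 2mn − 3 with no such subsequence. -/
open Finset

section AlternatingSums

variable {ι κ : Type*} [DecidableEq ι] [DecidableEq κ]

/-- The top finite difference of a product of fewer affine forms than variables vanishes. -/
lemma sum_powerset_neg_one_pow_mul_prod_eq_zero {R : Type*} [CommRing R] (g : κ → ι → R)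
    (s : Finset ι) (K : Finset κ) (hK : #K < #s) (c : κ → R) :
    ∑ A ∈ s.powerset, (-1) ^ #A * ∏ k ∈ K, (c k + ∑ i ∈ A, g k i) = 0 := by
  induction s using Finset.induction_on generalizing K c with
  | empty => simp at hK
  | insert x s hx ih =>
    rw [card_insert_of_notMem hx] at hK
    rw [sum_powerset_insert hx]
    have key : ∀ A ∈ s.powerset,
        (-1) ^ #(insert x A) * ∏ k ∈ K, (c k + ∑ i ∈ insert x A, g k i) =
        -((-1) ^ #A * ∏ k ∈ K, (c k + ∑ i ∈ A, g k i)) -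
          ∑ L ∈ K.powerset.erase K, (∏ k ∈ K \ L, g k x) *
            ((-1) ^ #A * ∏ k ∈ L, (c k + ∑ i ∈ A, g k i)) := by
      intro A hA
      have hxA : x ∉ A := fun h ↦ hx (mem_powerset.1 hA h)
      have : ∀ k, c k + ∑ i ∈ insert x A, g k i = (c k + ∑ i ∈ A, g k i) + g k x := by
        intro k
        rw [sum_insert hxA]
        ring
      simp only [this]
      rw [card_insert_of_notMem hxA, prod_add,
        ← add_sum_erase _ _ (mem_powerset_self K), mul_add, mul_sum, pow_succ]
      simp only [sdiff_self, bot_eq_empty, prod_empty, mul_one, mul_neg, neg_mul, sum_neg_distrib,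
        sub_eq_add_neg, add_right_inj, neg_inj]
      refine sum_congr rfl fun L _ ↦ ?_
      ring
    rw [sum_congr rfl key, sum_sub_distrib, sum_neg_distrib, sum_comm]
    have hz : ∀ L ∈ K.powerset.erase K, ∑ A ∈ s.powerset, (∏ k ∈ K \ L, g k x) *
        ((-1) ^ #A * ∏ k ∈ L, (c k + ∑ i ∈ A, g k i)) = 0 := by
      intro L hL
      rw [mem_erase, mem_powerset] at hL
      have := card_lt_card (hL.2.ssubset_of_ne hL.1)
      rw [← mul_sum, ih L (by omega), mul_zero]
    rw [sum_eq_zero hz]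
    ring

/-- Olson's congruence: over `𝔽_p`, the zero-sum subsequences of a sequence of length exceeding
`d (p - 1)` in `𝔽_p ^ d`, counted with sign, cancel. -/
lemma sum_filter_powerset_neg_one_pow_eq_zero {p : ℕ} [Fact p.Prime] (J : Finset κ)
    (g : κ → ι → ZMod p) (s : Finset ι) (hs : #J * (p - 1) < #s) :
    ∑ A ∈ s.powerset with ∀ j ∈ J, ∑ i ∈ A, g j i = 0, (-1 : ZMod p) ^ #A = 0 := by
  have h := sum_powerset_neg_one_pow_mul_prod_eq_zero (fun k : κ × ZMod p ↦ g k.1) s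
    (J ×ˢ univ.erase 0) (by simpa [card_product, ZMod.card] using hs) (fun k ↦ -k.2)
  set w : ZMod p := ∏ c ∈ univ.erase (0 : ZMod p), -c with hw
  have hw0 : w ≠ 0 := prod_ne_zero_iff.2 fun c hc ↦ neg_ne_zero.2 (ne_of_mem_erase hc)
  have key : ∀ A ∈ s.powerset,
      (-1 : ZMod p) ^ #A * ∏ k ∈ J ×ˢ univ.erase (0 : ZMod p), (-k.2 + ∑ i ∈ A, g k.1 i) =
      w ^ #J * if ∀ j ∈ J, ∑ i ∈ A, g j i = 0 then (-1 : ZMod p) ^ #A else 0 := by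
    intro A _
    rw [prod_product]
    split_ifs with hA
    · rw [mul_comm]
      congr 1
      rw [← prod_const]
      refine prod_congr rfl fun j hj ↦ ?_
      simp [hw, hA j hj]
    · push Not at hA
      obtain ⟨j, hj, hne⟩ := hA
      rw [mul_zero, prod_eq_zero hj, mul_zero]
      exact prod_eq_zero (mem_erase.2 ⟨hne, mem_univ _⟩) (by simp)
  rw [sum_congr rfl key, ← mul_sum] at h
  rw [sum_filter]
  exact (mul_eq_zero.1 h).resolve_left (pow_ne_zero _ hw0)

/-- The upper bound `D(C_p ^ d) ≤ d (p - 1) + 1`. -/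
lemma exists_nonempty_zero_sum {p : ℕ} [Fact p.Prime] (J : Finset κ)
    (g : κ → ι → ZMod p) (s : Finset ι) (hs : #J * (p - 1) < #s) :
    ∃ t ⊆ s, t.Nonempty ∧ ∀ j ∈ J, ∑ i ∈ t, g j i = 0 := by
  by_contra! hcon
  have h := sum_filter_powerset_neg_one_pow_eq_zero J g s hs
  have : {A ∈ s.powerset | ∀ j ∈ J, ∑ i ∈ A, g j i = 0} = {∅} := by
    ext A
    simp only [mem_filter, mem_powerset, mem_singleton]
    constructor
    · rintro ⟨hA, hz⟩
      by_contra hne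
      obtain ⟨j, hj, hj'⟩ := hcon A hA (nonempty_iff_ne_empty.2 hne)
      exact hj' (hz j hj)
    · rintro rfl
      simp
  simp [this] at h

end AlternatingSums

section Kemnitz

variable {ι : Type*} {p : ℕ}

/-- The number of zero-sum subsequences of length `k`. -/
def zeroSumCount {G : Type*} [AddCommMonoid G] [DecidableEq G] (f : ι → G) (k : ℕ)
    (s : Finset ι) : ℕ :=
  #{A ∈ s.powersetCard k | ∑ i ∈ A, f i = 0}

lemma zeroSumCount_eq_zero_iff {G : Type*} [AddCommMonoid G] [DecidableEq G] {f : ι → G} {k : ℕ}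
    {s : Finset ι} : zeroSumCount f k s = 0 ↔ ∀ A ⊆ s, #A = k → ∑ i ∈ A, f i ≠ 0 := by
  simp [zeroSumCount, filter_eq_empty_iff, mem_powersetCard]

lemma zeroSumCount_mono_eq_zero {G : Type*} [AddCommMonoid G] [DecidableEq G] {f : ι → G} {k : ℕ}
    {s t : Finset ι} (hst : s ⊆ t) (h : zeroSumCount f k t = 0) : zeroSumCount f k s = 0 :=
  zeroSumCount_eq_zero_iff.2 fun A hA ↦ zeroSumCount_eq_zero_iff.1 h A (hA.trans hst)

variable [DecidableEq ι]

lemma zeroSumCount_insert {G : Type*} [AddCommMonoid G] [DecidableEq G] {f : ι → G} (k : ℕ)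
    {s : Finset ι} {x : ι} (hx : x ∉ s) (hfx : f x = 0) :
    zeroSumCount f (k + 1) (insert x s) = zeroSumCount f (k + 1) s + zeroSumCount f k s := by
  unfold zeroSumCount
  rw [powersetCard_succ_insert hx, filter_union, card_union_of_disjoint, filter_image,
    card_image_of_injOn]
  · congr 2
    refine filter_congr fun A hA ↦ ?_
    rw [sum_insert fun h ↦ hx ((mem_powersetCard.1 hA).1 h), hfx, zero_add]
  · intro A hA B hB hAB
    have hA' : x ∉ A := fun h ↦ hx ((mem_powersetCard.1 (mem_filter.1 hA).1).1 h)
    have hB' : x ∉ B := fun h ↦ hx ((mem_powersetCard.1 (mem_filter.1 hB).1).1 h)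
    rw [← erase_insert hA', ← erase_insert hB']
    exact congrArg (fun s ↦ s.erase x) hAB
  · rw [disjoint_left]
    intro A hA hA'
    obtain ⟨B, -, rfl⟩ := mem_image.1 (mem_filter.1 hA').1
    exact hx ((mem_powersetCard.1 (mem_filter.1 hA).1).1 (mem_insert_self _ _))

/-- Averaging zero-sum counts over the complements of the `q`-subsets. -/
lemma sum_zeroSumCount_sdiff {G : Type*} [AddCommMonoid G] [DecidableEq G] (f : ι → G) (k q : ℕ)
    (s : Finset ι) :
    ∑ T ∈ s.powersetCard q, zeroSumCount f k (s \ T) =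
      (#s - k).choose q * zeroSumCount f k s := by
  have h1 : ∀ T ∈ s.powersetCard q, zeroSumCount f k (s \ T) =
      ∑ A ∈ (s \ T).powersetCard k with ∑ i ∈ A, f i = 0, 1 := fun T _ ↦ by
    simp [zeroSumCount]
  rw [sum_congr rfl h1, sum_comm' (t' := {A ∈ s.powersetCard k | ∑ i ∈ A, f i = 0})
    (s' := fun A ↦ (s \ A).powersetCard q)]
  · rw [sum_const_nat (m := (#s - k).choose q), mul_comm, zeroSumCount]
    intro A hA
    obtain ⟨hAs, hAk⟩ := mem_powersetCard.1 (mem_filter.1 hA).1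
    rw [sum_const, card_powersetCard, card_sdiff_of_subset hAs, hAk, smul_eq_mul, mul_one]
  · intro T A
    simp only [mem_filter, mem_powersetCard, subset_sdiff, disjoint_comm (a := A)]
    tauto

lemma zeroSumCount_congruence [Fact p.Prime] (hp : Odd p) (f : ι → ZMod p × ZMod p)
    (s : Finset ι) (h1 : 3 * p - 2 ≤ #s) (h2 : #s < 4 * p) :
    (1 : ZMod p) - zeroSumCount f p s + zeroSumCount f (2 * p) s - zeroSumCount f (3 * p) s
      = 0 := by
  have hp0 : 0 < p := (Fact.out : p.Prime).pos
  have h := sum_filter_powerset_neg_one_pow_eq_zero univ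
    ![fun i ↦ (f i).1, fun i ↦ (f i).2, fun _ ↦ (1 : ZMod p)] s
    (by simp only [card_univ, Fintype.card_fin]; omega)
  replace h : ∑ A ∈ s.powerset with ∑ i ∈ A, f i = 0 ∧ p ∣ #A, (-1 : ZMod p) ^ #A = 0 := by
    rw [← h]
    refine sum_congr ?_ fun _ _ ↦ rfl
    ext A
    simp [Fin.forall_fin_succ, Prod.ext_iff, Prod.fst_sum, Prod.snd_sum,
      ZMod.natCast_eq_zero_iff, and_assoc]
  rw [← sum_fiberwise_of_maps_to (t := range 4) (g := fun A ↦ #A / p)] at h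
  swap
  · intro A hA
    have := card_le_card (mem_powerset.1 (mem_filter.1 hA).1)
    rw [mem_range, Nat.div_lt_iff_lt_mul hp0]
    omega
  have key : ∀ j ∈ range 4, ∑ A ∈ {A ∈ s.powerset | ∑ i ∈ A, f i = 0 ∧ p ∣ #A} with #A / p = j,
      (-1 : ZMod p) ^ #A = (-1) ^ j * zeroSumCount f (j * p) s := by
    intro j _
    rw [zeroSumCount, filter_filter, mul_comm, ← nsmul_eq_mul, ← sum_const]
    have : {A ∈ s.powerset | (∑ i ∈ A, f i = 0 ∧ p ∣ #A) ∧ #A / p = j} =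
        {A ∈ s.powersetCard (j * p) | ∑ i ∈ A, f i = 0} := by
      ext A
      simp only [mem_filter, mem_powerset, mem_powersetCard]
      constructor
      · rintro ⟨hA, ⟨ha, hc⟩, rfl⟩
        exact ⟨⟨hA, (Nat.div_mul_cancel hc).symm⟩, ha⟩
      · rintro ⟨⟨hA, hc⟩, ha⟩
        exact ⟨hA, ⟨ha, hc ▸ dvd_mul_left _ _⟩, by rw [hc, Nat.mul_div_cancel _ hp0]⟩
    rw [this]
    refine sum_congr rfl fun A hA ↦ ?_
    rw [(mem_powersetCard.1 (mem_filter.1 hA).1).2, mul_comm, pow_mul, hp.neg_one_pow]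
  rw [sum_congr rfl key] at h
  have h0 : zeroSumCount f 0 s = 1 := by simp [zeroSumCount, filter_singleton]
  simp only [sum_range_succ, sum_range_zero, zero_mul, h0, one_mul] at h
  rw [← h]
  push_cast
  ring

lemma choose_prime_eq_div (p n : ℕ) [Fact p.Prime] : (n.choose p : ZMod p) = (n / p : ℕ) := by
  have hp := (Fact.out : p.Prime).pos
  have := Choose.choose_modEq_choose_mod_mul_choose_div_nat (n := n) (k := p) (p := p)
  rw [Nat.mod_self, Nat.div_self hp, Nat.choose_zero_right, Nat.choose_one_right, one_mul] at this
  exact (ZMod.natCast_eq_natCast_iff _ _ _).2 this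

lemma zeroSumCount_two_mul [Fact p.Prime] (hp : Odd p) {f : ι → ZMod p × ZMod p} {s : Finset ι}
    (h1 : 3 * p - 2 ≤ #s) (h2 : #s < 3 * p) (h : zeroSumCount f p s = 0) :
    (zeroSumCount f (2 * p) s : ZMod p) = -1 := by
  have h3 : zeroSumCount f (3 * p) s = 0 :=
    zeroSumCount_eq_zero_iff.2 fun A hA hAc ↦ by have := card_le_card hA; omega
  have := zeroSumCount_congruence hp f s h1 (by omega)
  rw [h, h3] at this
  push_cast at this
  linear_combination this

/-- A zero-sum sequence of length `3p` has a zero-sum subsequence of length `p`. -/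
lemma zeroSumCount_three_mul_eq_zero [Fact p.Prime] (hp : Odd p) {f : ι → ZMod p × ZMod p}
    {s : Finset ι} (h : zeroSumCount f p s = 0) : zeroSumCount f (3 * p) s = 0 := by
  have hp0 := (Fact.out : p.Prime).pos
  refine zeroSumCount_eq_zero_iff.2 fun C hC hCc hC0 ↦ ?_
  obtain ⟨x, hx⟩ : C.Nonempty := card_pos.1 (by omega)
  have h2 := zeroSumCount_two_mul hp (f := f) (s := C.erase x)
    (by rw [card_erase_of_mem hx]; omega) (by rw [card_erase_of_mem hx]; omega)
    (zeroSumCount_mono_eq_zero ((erase_subset _ _).trans hC) h)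
  have h3 : zeroSumCount f (2 * p) (C.erase x) ≠ 0 := by
    intro h0
    rw [h0] at h2
    simp at h2
  rw [ne_eq, zeroSumCount_eq_zero_iff] at h3
  push Not at h3
  obtain ⟨B, hB, hBc, hB0⟩ := h3
  have hBC := hB.trans (erase_subset _ _)
  refine zeroSumCount_eq_zero_iff.1 h (C \ B) (sdiff_subset.trans hC) ?_ ?_
  · rw [card_sdiff_of_subset hBC]
    omega
  · have := sum_sdiff (f := f) hBC
    rwa [hB0, hC0, add_zero] at this

/-- Double counting the pairs `(A, C)` of disjoint zero-sum subsequences of lengths `p - 1` and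
`2p`. -/
lemma zeroSumCount_sub_one_eq [Fact p.Prime] (hp : Odd p) {f : ι → ZMod p × ZMod p}
    {s : Finset ι} (hs : #s = 4 * p - 3) (h : zeroSumCount f p s = 0) :
    (zeroSumCount f (p - 1) s : ZMod p) = zeroSumCount f (3 * p - 1) s := by
  have hp2 := (Fact.out : p.Prime).two_le
  have hA : ∀ A ∈ {A ∈ s.powersetCard (p - 1) | ∑ i ∈ A, f i = 0},
      ∑ C ∈ (s \ A).powersetCard (2 * p) with ∑ i ∈ C, f i = 0, (1 : ZMod p) = -1 := by
    intro A hA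
    obtain ⟨hAs, hAc⟩ := mem_powersetCard.1 (mem_filter.1 hA).1
    have hc := card_sdiff_of_subset hAs
    rw [sum_const, nsmul_one]
    exact zeroSumCount_two_mul hp (by omega) (by omega)
      (zeroSumCount_mono_eq_zero sdiff_subset h)
  have hD : ∀ D ∈ {D ∈ s.powersetCard (3 * p - 1) | ∑ i ∈ D, f i = 0},
      ∑ C ∈ D.powersetCard (2 * p) with ∑ i ∈ C, f i = 0, (1 : ZMod p) = -1 := by
    intro D hD
    obtain ⟨hDs, hDc⟩ := mem_powersetCard.1 (mem_filter.1 hD).1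
    rw [sum_const, nsmul_one]
    exact zeroSumCount_two_mul hp (by omega) (by omega) (zeroSumCount_mono_eq_zero hDs h)
  have hAD : ∑ A ∈ s.powersetCard (p - 1) with ∑ i ∈ A, f i = 0,
      ∑ C ∈ (s \ A).powersetCard (2 * p) with ∑ i ∈ C, f i = 0, (1 : ZMod p) =
      ∑ D ∈ s.powersetCard (3 * p - 1) with ∑ i ∈ D, f i = 0,
        ∑ C ∈ D.powersetCard (2 * p) with ∑ i ∈ C, f i = 0, (1 : ZMod p) := by
    rw [sum_sigma', sum_sigma']
    refine sum_nbij' (fun x ↦ ⟨x.1 ∪ x.2, x.2⟩) (fun x ↦ ⟨x.1 \ x.2, x.2⟩) ?_ ?_ ?_ ?_ ?_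
    · rintro ⟨A, C⟩ hx
      simp only [mem_sigma, mem_filter, mem_powersetCard, subset_sdiff] at hx ⊢
      obtain ⟨⟨⟨hA, hAc⟩, hA0⟩, ⟨⟨hC, hd⟩, hCc⟩, hC0⟩ := hx
      refine ⟨⟨⟨union_subset hA hC, ?_⟩, ?_⟩, ⟨subset_union_right, hCc⟩, hC0⟩
      · rw [card_union_of_disjoint hd.symm]
        omega
      · rw [sum_union hd.symm, hA0, hC0, add_zero]
    · rintro ⟨D, C⟩ hx
      simp only [mem_sigma, mem_filter, mem_powersetCard, subset_sdiff] at hx ⊢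
      obtain ⟨⟨⟨hD, hDc⟩, hD0⟩, ⟨hC, hCc⟩, hC0⟩ := hx
      refine ⟨⟨⟨sdiff_subset.trans hD, ?_⟩, ?_⟩, ⟨⟨hC.trans hD, disjoint_sdiff⟩, hCc⟩, hC0⟩
      · rw [card_sdiff_of_subset hC]
        omega
      · have := sum_sdiff (f := f) hC
        rwa [hC0, hD0, add_zero] at this
    · rintro ⟨A, C⟩ hx
      simp only [mem_sigma, mem_filter, mem_powersetCard, subset_sdiff] at hx
      simp [union_sdiff_cancel_right hx.2.1.1.2.symm]
    · rintro ⟨D, C⟩ hx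
      simp only [mem_sigma, mem_filter, mem_powersetCard] at hx
      simp [sdiff_union_of_subset hx.2.1.1]
    · simp
  rw [sum_congr rfl hA, sum_congr rfl hD, sum_const, sum_const, smul_neg, smul_neg,
    nsmul_one, nsmul_one] at hAD
  exact neg_injective hAD

/-- Reiher's theorem for odd primes, in the presence of an additional zero element. -/
lemma zeroSumCount_prime_ne_zero [Fact p.Prime] (hp : Odd p) {f : ι → ZMod p × ZMod p}
    {s : Finset ι} (hs : #s = 4 * p - 3) {x : ι} (hx : x ∉ s) (hfx : f x = 0) :
    zeroSumCount f p s ≠ 0 := by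
  intro h
  have hp2 := (Fact.out : p.Prime).two_le
  have hp3 : 3 ≤ p := by
    obtain ⟨k, hk⟩ := hp
    omega
  have hins : ∀ {t : Finset ι}, x ∉ t → ∀ k, 0 < k → zeroSumCount f k (insert x t) =
      zeroSumCount f k t + zeroSumCount f (k - 1) t := by
    intro t ht k hk
    obtain ⟨k, rfl⟩ := Nat.exists_eq_succ_of_ne_zero hk.ne'
    exact zeroSumCount_insert k ht hfx
  have h3 := zeroSumCount_three_mul_eq_zero hp h
  have hN2 : (zeroSumCount f (2 * p) s : ZMod p) = -1 := by
    have := zeroSumCount_congruence hp f s (by omega) (by omega)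
    rw [h, h3] at this
    push_cast at this
    linear_combination this
  have hA := zeroSumCount_sub_one_eq hp hs h
  have hB := zeroSumCount_congruence hp f (insert x s)
    (by rw [card_insert_of_notMem hx]; omega) (by rw [card_insert_of_notMem hx]; omega)
  rw [hins hx p (by omega), hins hx (2 * p) (by omega), hins hx (3 * p) (by omega), h, h3] at hB
  push_cast at hB
  have hT : ∀ T ∈ s.powersetCard p, (1 : ZMod p) - zeroSumCount f (p - 1) (s \ T) +
      zeroSumCount f (2 * p) (s \ T) + zeroSumCount f (2 * p - 1) (s \ T) = 0 := by
    intro T hT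
    obtain ⟨hTs, hTc⟩ := mem_powersetCard.1 hT
    have hc := card_sdiff_of_subset hTs
    have hxT : x ∉ s \ T := fun h ↦ hx (mem_sdiff.1 h).1
    have hci := card_insert_of_notMem hxT
    have := zeroSumCount_congruence hp f (insert x (s \ T)) (by omega) (by omega)
    have h0 : zeroSumCount f (3 * p) (insert x (s \ T)) = 0 :=
      zeroSumCount_eq_zero_iff.2 fun A hA hAc ↦ by have := card_le_card hA; omega
    rw [h0, hins hxT p (by omega), hins hxT (2 * p) (by omega),
      zeroSumCount_mono_eq_zero sdiff_subset h] at this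
    push_cast at this
    linear_combination this
  have hsum := sum_eq_zero hT
  have hch : ∀ k, ∑ T ∈ s.powersetCard p, (zeroSumCount f k (s \ T) : ZMod p) =
      ((4 * p - 3 - k) / p : ℕ) * zeroSumCount f k s := by
    intro k
    rw [← Nat.cast_sum, sum_zeroSumCount_sdiff, Nat.cast_mul, choose_prime_eq_div, hs]
  rw [sum_add_distrib, sum_add_distrib, sum_sub_distrib, hch, hch, hch, sum_const,
    card_powersetCard, nsmul_one, choose_prime_eq_div, hs,
    Nat.div_eq_of_lt_le (k := 3) (by omega) (by omega),
    Nat.div_eq_of_lt_le (k := 2) (m := 4 * p - 3 - (p - 1)) (by omega) (by omega),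
    Nat.div_eq_of_lt_le (k := 1) (m := 4 * p - 3 - 2 * p) (by omega) (by omega),
    Nat.div_eq_of_lt_le (k := 1) (m := 4 * p - 3 - (2 * p - 1)) (by omega) (by omega)] at hsum
  push_cast at hsum
  have h2 : ((2 : ℕ) : ZMod p) = 0 := by
    push_cast
    linear_combination hsum - hB + hA
  have := Nat.le_of_dvd two_pos ((ZMod.natCast_eq_zero_iff _ _).1 h2)
  omega

/-- The **Kemnitz conjecture** (Reiher's theorem) for primes. -/
theorem exists_card_eq_prime_zero_sum [Fact p.Prime] (f : ι → ZMod p × ZMod p)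
    (s : Finset ι) (hs : 4 * p - 3 ≤ #s) : ∃ t ⊆ s, #t = p ∧ ∑ i ∈ t, f i = 0 := by
  obtain ⟨s', hsub, hs'⟩ := exists_subset_card_eq hs
  rcases (Fact.out : p.Prime).eq_two_or_odd' with rfl | hp
  · obtain ⟨i, hi, j, hj, hij, h⟩ := exists_ne_map_eq_of_card_lt_of_maps_to (s := s')
      (t := univ) (f := f) (by rw [hs']; decide) (fun _ _ ↦ mem_coe.2 (mem_univ _))
    refine ⟨{i, j}, (insert_subset hi (singleton_subset_iff.2 hj)).trans hsub, card_pair hij, ?_⟩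
    rw [sum_pair hij, h]
    exact Prod.ext (CharTwo.add_self_eq_zero _) (CharTwo.add_self_eq_zero _)
  · have := zeroSumCount_prime_ne_zero hp (f := fun o : Option ι ↦ o.elim 0 f)
      (s := s'.map .some) (by rw [card_map, hs']) (x := none) (by simp) rfl
    rw [ne_eq, zeroSumCount_eq_zero_iff] at this
    push Not at this
    obtain ⟨A, hA, hAc, hA0⟩ := this
    obtain ⟨B, hB, rfl⟩ := subset_map_iff.1 hA
    exact ⟨B, hB.trans hsub, by simpa using hAc, by simpa using hA0⟩

end Kemnitz

section Induction

/-- If every large enough subset of `s` contains a `q`-subset satisfying `P`, then `s` contains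
many pairwise disjoint such subsets. -/
lemma exists_pairwise_disjoint_family {ι : Type*} [DecidableEq ι] {P : Finset ι → Prop} {L q : ℕ}
    (hq : 0 < q) {s : Finset ι} (hP : ∀ u ⊆ s, L ≤ #u → ∃ t ⊆ u, #t = q ∧ P t) (k : ℕ)
    (hk : L + k * q ≤ #s + q) :
    ∃ 𝒜 : Finset (Finset ι), #𝒜 = k ∧ (𝒜 : Set (Finset ι)).PairwiseDisjoint id ∧
      ∀ t ∈ 𝒜, t ⊆ s ∧ #t = q ∧ P t := by
  induction k with
  | zero => exact ⟨∅, by simp⟩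
  | succ k ih =>
    rw [add_mul, one_mul] at hk
    obtain ⟨𝒜, hcard, hdisj, h𝒜⟩ := ih (by omega)
    have hU : #(𝒜.biUnion id) ≤ k * q := by
      rw [← hcard]
      exact card_biUnion_le_card_mul _ _ _ fun t ht ↦ (h𝒜 t ht).2.1.le
    obtain ⟨t₀, ht₀, ht₀card, ht₀P⟩ := hP (s \ 𝒜.biUnion id) sdiff_subset
      (by have := le_card_sdiff (𝒜.biUnion id) s; omega)
    have hd : ∀ t ∈ 𝒜, Disjoint t₀ t := fun t ht ↦
      sdiff_disjoint.mono ht₀ (subset_biUnion_of_mem id ht)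
    have hmem : t₀ ∉ 𝒜 := fun h ↦ by
      have := disjoint_self_iff_empty _ |>.1 (hd t₀ h)
      simp [this] at ht₀card
      omega
    refine ⟨insert t₀ 𝒜, by rw [card_insert_of_notMem hmem, hcard], ?_, ?_⟩
    · rw [coe_insert, Set.pairwiseDisjoint_insert]
      exact ⟨hdisj, fun t ht _ ↦ hd t ht⟩
    · rw [forall_mem_insert]
      exact ⟨⟨ht₀.trans sdiff_subset, ht₀card, ht₀P⟩, h𝒜⟩

/-- Every sequence of `K` elements of `ℤ × ℤ` with weights equal to `1`, up to one weight which may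
be `2`, has a nonempty subsequence whose sum vanishes modulo `(m, N)` and whose total weight
vanishes modulo `N`. -/
def HasWeightedZeroSum (m N K : ℕ) : Prop :=
  ∀ (ι : Type) [DecidableEq ι] (a b : ι → ℤ) (w : ι → ℕ) (s : Finset ι) (i₀ : ι), i₀ ∈ s →
    #s = K → (∀ i ∈ s, i ≠ i₀ → w i = 1) → 0 < w i₀ → w i₀ ≤ 2 →
    ∃ t ⊆ s, t.Nonempty ∧ (m : ℤ) ∣ ∑ i ∈ t, a i ∧ (N : ℤ) ∣ ∑ i ∈ t, b i ∧ N ∣ ∑ i ∈ t, w i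

/-- The inductive step: blocks of length `p` reduce `(d m, p N)` to `(m, N)`. -/
lemma HasWeightedZeroSum.mul {d p R m N K : ℕ} (hp : 0 < p) (hR : 0 < R) (hRp : R + 2 ≤ 3 * p)
    (hshort : ∀ (ι : Type) [DecidableEq ι] (a b : ι → ℤ) (s : Finset ι), R + p - 1 ≤ #s →
      ∃ t ⊆ s, #t = p ∧ (d : ℤ) ∣ ∑ i ∈ t, a i ∧ (p : ℤ) ∣ ∑ i ∈ t, b i)
    (hlong : ∀ (ι : Type) [DecidableEq ι] (a b : ι → ℤ) (w : ι → ℕ) (s : Finset ι), R ≤ #s →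
      ∃ t ⊆ s, t.Nonempty ∧ (d : ℤ) ∣ ∑ i ∈ t, a i ∧ (p : ℤ) ∣ ∑ i ∈ t, b i ∧ p ∣ ∑ i ∈ t, w i)
    (h : HasWeightedZeroSum m N (K + 1)) : HasWeightedZeroSum (d * m) (p * N) (K * p + R) := by
  intro ι _ a b w s i₀ hi₀ hs hw hw0 hw2
  obtain ⟨𝒜, hcard, hdisj, h𝒜⟩ := exists_pairwise_disjoint_family hp (s := s.erase i₀)
    (fun u _ hu ↦ hshort ι a b u hu) K (by rw [card_erase_of_mem hi₀]; omega)
  have hU : #(𝒜.biUnion id) ≤ K * p := by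
    rw [← hcard]
    exact card_biUnion_le_card_mul _ _ _ fun t ht ↦ (h𝒜 t ht).2.1.le
  obtain ⟨r, hr, hrc⟩ := exists_subset_card_eq (s := s \ 𝒜.biUnion id) (n := R)
    (by have := le_card_sdiff (𝒜.biUnion id) s; omega)
  obtain ⟨t₀, ht₀, hne, hta, htb, htw⟩ := hlong ι a b w r hrc.ge
  have ht₀s : t₀ ⊆ s := (ht₀.trans hr).trans sdiff_subset
  have hd : ∀ t ∈ 𝒜, Disjoint t₀ t := fun t ht ↦
    sdiff_disjoint.mono (ht₀.trans hr) (subset_biUnion_of_mem id ht)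
  have hmem : t₀ ∉ 𝒜 := fun h ↦
    hne.ne_empty (disjoint_self_iff_empty _ |>.1 (hd t₀ h))
  have hpos : ∀ i ∈ s, 0 < w i := fun i hi ↦ by
    by_cases hii : i = i₀
    · rwa [hii]
    · rw [hw i hi hii]
      exact one_pos
  have hw𝒜 : ∀ t ∈ 𝒜, ∑ i ∈ t, w i = p := fun t ht ↦ by
    rw [sum_congr rfl fun i hi ↦ hw i (mem_of_mem_erase ((h𝒜 t ht).1 hi))
      (ne_of_mem_erase ((h𝒜 t ht).1 hi))]
    simpa using (h𝒜 t ht).2.1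
  have hwt₀ : ∑ i ∈ t₀, w i ≤ #t₀ + 1 := by
    calc ∑ i ∈ t₀, w i ≤ ∑ i ∈ t₀, (1 + if i = i₀ then 1 else 0) := by
          refine sum_le_sum fun i hi ↦ ?_
          split_ifs with hii
          · rwa [hii]
          · exact (hw i (ht₀s hi) hii).le
      _ ≤ #t₀ + 1 := by
          rw [sum_add_distrib, sum_const, smul_eq_mul, mul_one, sum_ite_eq']
          split_ifs <;> omega
  have ht₀c := card_le_card ht₀
  have hwpos : 0 < ∑ i ∈ t₀, w i := sum_pos (fun i hi ↦ hpos i (ht₀s hi)) hne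
  have hdvd : ∀ t ∈ insert t₀ 𝒜, t ⊆ s ∧ t.Nonempty ∧ (d : ℤ) ∣ ∑ i ∈ t, a i ∧
      (p : ℤ) ∣ ∑ i ∈ t, b i ∧ p ∣ ∑ i ∈ t, w i := by
    rw [forall_mem_insert]
    refine ⟨⟨ht₀s, hne, hta, htb, htw⟩, fun t ht ↦ ?_⟩
    obtain ⟨h1, h2, h3, h4⟩ := h𝒜 t ht
    exact ⟨h1.trans (erase_subset _ _), card_pos.1 (by omega), h3, h4, by rw [hw𝒜 t ht]⟩
  have hdisj' : ((insert t₀ 𝒜 : Finset (Finset ι)) : Set (Finset ι)).PairwiseDisjoint id := by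
    rw [coe_insert, Set.pairwiseDisjoint_insert]
    exact ⟨hdisj, fun t ht _ ↦ hd t ht⟩
  obtain ⟨ℬ, hℬ, ⟨t₁, ht₁⟩, hBa, hBb, hBw⟩ := h (Finset ι) (fun t ↦ (∑ i ∈ t, a i) / d)
    (fun t ↦ (∑ i ∈ t, b i) / p) (fun t ↦ (∑ i ∈ t, w i) / p) (insert t₀ 𝒜) t₀
    (mem_insert_self _ _) (by rw [card_insert_of_notMem hmem, hcard])
    (fun t ht htne ↦ by
      simp only [hw𝒜 t (mem_of_mem_insert_of_ne ht htne), Nat.div_self hp])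
    (Nat.div_pos (Nat.le_of_dvd hwpos htw) hp)
    (Nat.lt_succ_iff.1 ((Nat.div_lt_iff_lt_mul hp).2 (by omega)))
  have hBd : (ℬ : Set (Finset ι)).PairwiseDisjoint id := hdisj'.subset (coe_subset.2 hℬ)
  refine ⟨ℬ.biUnion id, biUnion_subset.2 fun t ht ↦ (hdvd t (hℬ ht)).1, ?_, ?_, ?_, ?_⟩
  · obtain ⟨i, hi⟩ := (hdvd t₁ (hℬ ht₁)).2.1
    exact ⟨i, mem_biUnion.2 ⟨t₁, ht₁, hi⟩⟩
  · rw [sum_biUnion hBd, Nat.cast_mul]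
    have e : ∑ t ∈ ℬ, ∑ i ∈ id t, a i = d * ∑ t ∈ ℬ, (∑ i ∈ t, a i) / d := by
      rw [mul_sum]
      exact sum_congr rfl fun t ht ↦ (Int.mul_ediv_cancel' (hdvd t (hℬ ht)).2.2.1).symm
    rw [e]
    exact mul_dvd_mul_left _ hBa
  · rw [sum_biUnion hBd, Nat.cast_mul]
    have e : ∑ t ∈ ℬ, ∑ i ∈ id t, b i = p * ∑ t ∈ ℬ, (∑ i ∈ t, b i) / p := by
      rw [mul_sum]
      exact sum_congr rfl fun t ht ↦ (Int.mul_ediv_cancel' (hdvd t (hℬ ht)).2.2.2.1).symm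
    rw [e]
    exact mul_dvd_mul_left _ hBb
  · rw [sum_biUnion hBd]
    have e : ∑ t ∈ ℬ, ∑ i ∈ id t, w i = p * ∑ t ∈ ℬ, (∑ i ∈ t, w i) / p := by
      rw [mul_sum]
      exact sum_congr rfl fun t ht ↦ (Nat.mul_div_cancel' (hdvd t (hℬ ht)).2.2.2.2).symm
    rw [e]
    exact mul_dvd_mul_left _ hBw

lemma hasWeightedZeroSum_one_left (N : ℕ) (hN : 0 < N) :
    HasWeightedZeroSum 1 N (2 * N - 1) := by
  induction N using induction_on_primes with
  | zero => exact absurd hN (lt_irrefl 0)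
  | one => exact fun ι _ a b w s i₀ hi₀ _ _ _ _ ↦ ⟨{i₀}, by simpa using hi₀, by simp⟩
  | prime_mul p N hp ih =>
    have hN' : 0 < N := Nat.pos_of_mul_pos_left hN
    have := Fact.mk hp
    have hp2 := hp.two_le
    have ih' : HasWeightedZeroSum 1 N (2 * N - 2 + 1) := by
      convert ih hN' using 1
      omega
    have key := HasWeightedZeroSum.mul (d := 1) (p := p) (R := 2 * p - 1) (by omega) (by omega)
      (by omega) ?_ ?_ ih'
    · convert key using 1
      have h3 : 2 * p ≤ 2 * N * p := Nat.mul_le_mul_right p (by omega)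
      have h4 : 2 * N * p = 2 * (p * N) := by ring
      rw [Nat.sub_mul]
      omega
    · intro ι _ a b s hs
      obtain ⟨t, ht, htc, htb⟩ := Int.erdos_ginzburg_ziv (n := p) b (s := s) (by omega)
      exact ⟨t, ht, htc, by simp, htb⟩
    · intro ι _ a b w s hs
      obtain ⟨t, ht, hne, hz⟩ := exists_nonempty_zero_sum (p := p) (univ : Finset Bool)
        (fun j i ↦ cond j (b i : ZMod p) (w i)) s
        (by simp only [card_univ, Fintype.card_bool]; omega)
      have h1 := hz true (mem_univ _)
      have h2 := hz false (mem_univ _)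
      simp only [cond_true, cond_false] at h1 h2
      refine ⟨t, ht, hne, by simp, ?_, ?_⟩
      · rw [← ZMod.intCast_zmod_eq_zero_iff_dvd]
        exact_mod_cast h1
      · rw [← ZMod.natCast_eq_zero_iff]
        exact_mod_cast h2

lemma hasWeightedZeroSum (m n : ℕ) (hm : 0 < m) (hn : 0 < n) :
    HasWeightedZeroSum m (m * n) (m + 2 * (m * n) - 2) := by
  induction m using induction_on_primes with
  | zero => exact absurd hm (lt_irrefl 0)
  | one =>
    convert hasWeightedZeroSum_one_left n hn using 1
    · rw [one_mul]
    · omega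
  | prime_mul p m hp ih =>
    have hm' : 0 < m := Nat.pos_of_mul_pos_left hm
    have := Fact.mk hp
    have hp2 := hp.two_le
    have hmn : 0 < m * n := Nat.mul_pos hm' hn
    have ih' : HasWeightedZeroSum m (m * n) (m + 2 * (m * n) - 3 + 1) := by
      convert ih hm' using 1
      omega
    have key := HasWeightedZeroSum.mul (d := p) (p := p) (R := 3 * p - 2) (by omega) (by omega)
      (by omega) ?_ ?_ ih'
    · convert key using 1
      · rw [mul_assoc]
      · have h3 : 3 * p ≤ (m + 2 * (m * n)) * p := Nat.mul_le_mul_right p (by omega)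
        have h4 : (m + 2 * (m * n)) * p = p * m + 2 * (p * m * n) := by ring
        rw [Nat.sub_mul]
        omega
    · intro ι _ a b s hs
      obtain ⟨t, ht, htc, hz⟩ := exists_card_eq_prime_zero_sum (p := p)
        (fun i ↦ ((a i : ZMod p), (b i : ZMod p))) s (by omega)
      rw [Prod.ext_iff, Prod.fst_sum, Prod.snd_sum] at hz
      refine ⟨t, ht, htc, ?_, ?_⟩
      · rw [← ZMod.intCast_zmod_eq_zero_iff_dvd]
        exact_mod_cast hz.1
      · rw [← ZMod.intCast_zmod_eq_zero_iff_dvd]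
        exact_mod_cast hz.2
    · intro ι _ a b w s hs
      obtain ⟨t, ht, hne, hz⟩ := exists_nonempty_zero_sum (p := p) (univ : Finset (Option Bool))
        (fun j i ↦ j.elim (a i : ZMod p) fun j ↦ cond j (b i : ZMod p) (w i)) s
        (by simp only [card_univ, Fintype.card_option, Fintype.card_bool]; omega)
      have h0 := hz none (mem_univ _)
      have h1 := hz (some true) (mem_univ _)
      have h2 := hz (some false) (mem_univ _)
      simp only [Option.elim, cond_true, cond_false] at h0 h1 h2
      refine ⟨t, ht, hne, ?_, ?_, ?_⟩
      · rw [← ZMod.intCast_zmod_eq_zero_iff_dvd]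
        exact_mod_cast h0
      · rw [← ZMod.intCast_zmod_eq_zero_iff_dvd]
        exact_mod_cast h1
      · rw [← ZMod.natCast_eq_zero_iff]
        exact_mod_cast h2

end Induction


/-- For `G = C_m ⊕ C_{mn}`, `s_{exp(G)ℕ}(G) = m + 2mn - 2`: every sequence
of length at least `m + 2mn - 2` has a zero-sum subsequence of length a positive multiple
of `mn = exp(G)`, and there is a sequence of length `m + 2mn - 3` with none. -/
theorem stmt_11 (m n : ℕ) (hm : 0 < m) (hn : 0 < n) :
    (∀ S : Multiset (ZMod m × ZMod (m * n)), m + 2 * (m * n) - 2 ≤ S.card →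
      ∃ T ≤ S, T.sum = 0 ∧ ∃ k : ℕ, 0 < k ∧ Multiset.card T = k * (m * n)) ∧
    (∃ S : Multiset (ZMod m × ZMod (m * n)), S.card = m + 2 * (m * n) - 3 ∧
      ¬ ∃ T ≤ S, T.sum = 0 ∧ ∃ k : ℕ, 0 < k ∧ Multiset.card T = k * (m * n)) := by
  have hmn : 0 < m * n := Nat.mul_pos hm hn
  have := NeZero.of_pos hm
  have := NeZero.of_pos hmn
  constructor
  · intro S hS
    obtain ⟨s, hsS, hs⟩ := exists_subset_card_eq (hS.trans_eq S.card_toEnumFinset.symm)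
    obtain ⟨i₀, hi₀⟩ : s.Nonempty := card_pos.1 (by omega)
    obtain ⟨t, ht, hne, ha, hb, hw⟩ := hasWeightedZeroSum m n hm hn _ (fun x ↦ (x.1.1.val : ℤ))
      (fun x ↦ (x.1.2.val : ℤ)) (fun _ ↦ 1) s i₀ hi₀ hs (fun _ _ _ ↦ rfl) one_pos one_le_two
    rw [sum_const, smul_eq_mul, mul_one] at hw
    obtain ⟨k, hk⟩ := hw
    refine ⟨t.1.map Prod.fst, Multiset.map_fst_le_of_subset_toEnumFinset (ht.trans hsS), ?_, k,
      ?_, ?_⟩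
    · rw [← ZMod.intCast_zmod_eq_zero_iff_dvd] at ha hb
      push_cast [ZMod.natCast_zmod_val] at ha hb
      change ∑ x ∈ t, x.1 = 0
      rw [Prod.ext_iff, Prod.fst_sum, Prod.snd_sum]
      exact ⟨ha, hb⟩
    · refine Nat.pos_of_ne_zero fun h ↦ ?_
      rw [h, mul_zero] at hk
      exact hne.card_pos.ne' hk
    · rw [Multiset.card_map, ← mul_comm (m * n) k]
      exact hk
  · refine ⟨Multiset.replicate (m - 1) (1, 0) + (Multiset.replicate (m * n - 1) (0, 1) +
      Multiset.replicate (m * n - 1) 0), ?_, ?_⟩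
    · simp only [Multiset.card_add, Multiset.card_replicate]
      omega
    · rintro ⟨T, hT, hT0, k, hk, hTk⟩
      have key : ∀ {A B U : Multiset (ZMod m × ZMod (m * n))}, U ≤ A + B →
          ∃ V ≤ A, ∃ W ≤ B, U = V + W := fun {A B U} h ↦
        ⟨U ∩ A, Multiset.inter_le_right, U - A, tsub_le_iff_left.2 h, by
          rw [add_comm, Multiset.sub_add_inter]⟩
      obtain ⟨A, hA, W, hW, rfl⟩ := key hT
      obtain ⟨B, hB, C, hC, rfl⟩ := key hW
      obtain ⟨α, hα, rfl⟩ := Multiset.le_replicate_iff.1 hA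
      obtain ⟨β, hβ, rfl⟩ := Multiset.le_replicate_iff.1 hB
      obtain ⟨γ, hγ, rfl⟩ := Multiset.le_replicate_iff.1 hC
      have h1 : m ∣ α := by
        rw [← ZMod.natCast_eq_zero_iff]
        simpa using congrArg Prod.fst hT0
      have h2 : m * n ∣ β := by
        rw [← ZMod.natCast_eq_zero_iff]
        simpa using congrArg Prod.snd hT0
      have hα0 := Nat.eq_zero_of_dvd_of_lt h1 (by omega)
      have hβ0 := Nat.eq_zero_of_dvd_of_lt h2 (by omega)
      simp only [Multiset.card_add, Multiset.card_replicate] at hTk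
      have := Nat.le_mul_of_pos_left (m * n) hk
      omega
end

section
/- Let m, n be positive integers and let G = C_m ⊕ C_{mn}. Then s(G) = 2m + 2mn − 3; that is, every sequence over G of length at least 2m + 2mn − 3 has a zero-sum subsequence of length exactly mn = exp(G), and there exists a sequence over G of length 2m + 2mn − 4 with no zero-sum subsequence of length mn. -/
/-- Every multiset over `G` with at least `L` elements has a zero-sum submultiset of
cardinality `k`. -/
def ForcesZeroSum (G : Type*) [AddCommMonoid G] (k L : ℕ) : Prop :=
  ∀ S : Multiset G, L ≤ S.card → ∃ T ≤ S, T.sum = 0 ∧ Multiset.card T = k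

theorem Multiset.exists_le_map_eq {α β : Type*} (f : α → β) {t : Multiset β} {s : Multiset α}
    (h : t ≤ s.map f) : ∃ u ≤ s, u.map f = t := by
  induction s, t using Quotient.inductionOn₂ with
  | _ s t =>
    obtain ⟨t', ht', hs⟩ := Multiset.coe_le.1 h
    obtain ⟨u, hu, rfl⟩ := List.sublist_map_iff.1 hs
    exact ⟨u, hu.subperm, Multiset.coe_eq_coe.2 ht'⟩

namespace ForcesZeroSum

/-- Greedily extract `r` disjoint blocks. -/
theorem exists_blocks {G H : Type*} [AddCommGroup G] [AddCommGroup H] (φ : G →+ H) {a L : ℕ}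
    (hH : ForcesZeroSum H a L) (r : ℕ) (S : Multiset G) (hS : a * (r - 1) + L ≤ S.card) :
    ∃ B : Multiset (Multiset G), B.card = r ∧ B.sum ≤ S ∧
      ∀ T ∈ B, Multiset.card T = a ∧ φ T.sum = 0 := by
  induction r generalizing S with
  | zero => exact ⟨0, by simp⟩
  | succ r ih =>
    obtain ⟨T', hT', hT's, hT'c⟩ := hH (S.map φ) (by rw [Multiset.card_map]; lia)
    obtain ⟨T, hT, rfl⟩ := Multiset.exists_le_map_eq _ hT'
    obtain ⟨R, rfl⟩ := Multiset.le_iff_exists_add.1 hT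
    rw [Multiset.card_map] at hT'c
    rcases Nat.eq_zero_or_pos r with rfl | hr
    · refine ⟨{T}, by simp, by simp, ?_⟩
      simp [hT'c, map_multiset_sum, hT's]
    · obtain ⟨B, hB, hBR, hBT⟩ := ih R (by
        obtain ⟨r, rfl⟩ := Nat.exists_eq_add_of_lt hr
        simp only [Multiset.card_add, hT'c, zero_add, Nat.add_sub_cancel, mul_add, mul_one] at hS ⊢
        lia)
      refine ⟨T ::ₘ B, by simp [hB], by simpa using hBR, ?_⟩
      intro U hU
      rcases Multiset.mem_cons.1 hU with rfl | hU
      · exact ⟨hT'c, by rw [map_multiset_sum, hT's]⟩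
      · exact hBT U hU

/-- Bounds for the outer terms of an exact sequence `K → G → H` give one for `G`. -/
theorem of_exact {K G H : Type*} [AddCommGroup K] [AddCommGroup G] [AddCommGroup H]
    (ψ : K →+ G) (φ : G →+ H) (hex : ∀ g, φ g = 0 → ∃ k, ψ k = g) {a b L M : ℕ}
    (hH : ForcesZeroSum H a L) (hK : ForcesZeroSum K b M) :
    ForcesZeroSum G (a * b) (a * (M - 1) + L) := by
  intro S hS
  obtain ⟨B, hB, hBS, hBT⟩ := exists_blocks φ hH M S hS
  choose! lift hlift using hex
  obtain ⟨C', hC', hC's, hC'c⟩ := hK (B.map fun T => lift T.sum) (by simp [hB])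
  obtain ⟨C, hC, rfl⟩ := Multiset.exists_le_map_eq _ hC'
  rw [Multiset.card_map] at hC'c
  have hmem : ∀ T ∈ C, Multiset.card T = a ∧ φ T.sum = 0 := fun T hT =>
    hBT T (Multiset.mem_of_le hC hT)
  refine ⟨C.sum, ?_, ?_, ?_⟩
  · obtain ⟨D, rfl⟩ := Multiset.le_iff_exists_add.1 hC
    rw [Multiset.sum_add] at hBS
    exact (Multiset.le_add_right _ _).trans hBS
  · have h : C.map Multiset.sum = C.map fun T => ψ (lift T.sum) :=
      Multiset.map_congr rfl fun T hT => (hlift _ (hmem T hT).2).symm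
    have h2 := congrArg ψ hC's
    rw [map_multiset_sum, Multiset.map_map, map_zero] at h2
    rw [← Multiset.coe_sumAddMonoidHom, map_multiset_sum, Multiset.coe_sumAddMonoidHom, h]
    exact h2
  · rw [← Multiset.join, Multiset.card_join,
      Multiset.map_congr rfl fun T hT => (hmem T hT).1, Multiset.map_const', Multiset.sum_replicate,
      hC'c, smul_eq_mul, mul_comm]

end ForcesZeroSum

/-- Multiplication by `a` as a map `ℤ/b → ℤ/ab`. -/
def ZMod.mulLeftHom (a b : ℕ) : ZMod b →+ ZMod (a * b) :=
  ZMod.lift b ⟨(Int.castAddHom (ZMod (a * b))).comp (AddMonoidHom.mulLeft (a : ℤ)), by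
    simp only [AddMonoidHom.comp_apply, AddMonoidHom.coe_mulLeft, Int.coe_castAddHom]
    exact_mod_cast ZMod.natCast_self (a * b)⟩

theorem ZMod.exists_mulLeftHom_eq {a b : ℕ} (g : ZMod (a * b))
    (hg : ZMod.castHom (dvd_mul_right a b) (ZMod a) g = 0) : ∃ k, ZMod.mulLeftHom a b k = g := by
  obtain ⟨z, rfl⟩ := ZMod.intCast_surjective g
  rw [map_intCast, ZMod.intCast_zmod_eq_zero_iff_dvd] at hg
  obtain ⟨k, rfl⟩ := hg
  exact ⟨k, by simp [ZMod.mulLeftHom]⟩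

theorem ForcesZeroSum.square_mul {a b : ℕ} (hb : 0 < b)
    (h₁ : ForcesZeroSum (ZMod a × ZMod a) a (4 * a - 3))
    (h₂ : ForcesZeroSum (ZMod b × ZMod b) b (4 * b - 3)) :
    ForcesZeroSum (ZMod (a * b) × ZMod (a * b)) (a * b) (4 * (a * b) - 3) := by
  let c := (ZMod.castHom (dvd_mul_right a b) (ZMod a)).toAddMonoidHom
  have key := of_exact ((ZMod.mulLeftHom a b).prodMap (ZMod.mulLeftHom a b)) (c.prodMap c) (by
    rintro ⟨x, y⟩ h
    obtain ⟨hx, hy⟩ := Prod.ext_iff.1 h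
    obtain ⟨k, rfl⟩ := ZMod.exists_mulLeftHom_eq x hx
    obtain ⟨l, rfl⟩ := ZMod.exists_mulLeftHom_eq y hy
    exact ⟨(k, l), rfl⟩) h₁ h₂
  intro S hS
  refine key S (le_trans ?_ hS)
  obtain ⟨b, rfl⟩ := Nat.exists_eq_add_of_lt hb
  rw [show 4 * (0 + b + 1) - 3 - 1 = 4 * b by lia]
  ring_nf
  lia

theorem ForcesZeroSum.prod_mul {m n : ℕ} (hn : 0 < n)
    (h : ForcesZeroSum (ZMod m × ZMod m) m (4 * m - 3)) :
    ForcesZeroSum (ZMod m × ZMod (m * n)) (m * n) (2 * m + 2 * (m * n) - 3) := by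
  have hEGZ : ForcesZeroSum (ZMod n) n (2 * n - 1) := fun S hS => by
    obtain ⟨T, h1, h2, h3⟩ := ZMod.erdos_ginzburg_ziv_multiset S hS
    exact ⟨T, h1, h3, h2⟩
  let c := (ZMod.castHom (dvd_mul_right m n) (ZMod m)).toAddMonoidHom
  have key := of_exact ((AddMonoidHom.inr (ZMod m) (ZMod (m * n))).comp (ZMod.mulLeftHom m n))
    ((AddMonoidHom.id _).prodMap c) (by
    rintro ⟨x, y⟩ h
    obtain ⟨hx, hy⟩ := Prod.ext_iff.1 h
    obtain ⟨l, rfl⟩ := ZMod.exists_mulLeftHom_eq y hy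
    exact ⟨l, Prod.ext hx.symm rfl⟩) h hEGZ
  intro S hS
  refine key S (le_trans ?_ hS)
  obtain ⟨n, rfl⟩ := Nat.exists_eq_add_of_lt hn
  rw [show 2 * (0 + n + 1) - 1 - 1 = 2 * n by lia]
  ring_nf
  lia

/-- Two elements of multiplicity `mn - 1` and two of multiplicity `m - 1` show that the bound is
sharp. -/
theorem exists_no_zeroSum (m n : ℕ) (hm : 0 < m) (hn : 0 < n) :
    ∃ S : Multiset (ZMod m × ZMod (m * n)), S.card = 2 * m + 2 * (m * n) - 4 ∧
      ¬ ∃ T ≤ S, T.sum = 0 ∧ Multiset.card T = m * n := by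
  have hmn : 0 < m * n := Nat.mul_pos hm hn
  have split : ∀ {T A B : Multiset (ZMod m × ZMod (m * n))}, T ≤ A + B →
      ∃ U ≤ A, ∃ V ≤ B, T = U + V := fun {T A B} h => by
    classical
    refine ⟨T ∩ A, Multiset.inter_le_right, T - A, ?_, ?_⟩
    · rwa [tsub_le_iff_left]
    · rw [add_comm, Multiset.sub_add_inter]
  refine ⟨.replicate (m * n - 1) (0, 0) + .replicate (m * n - 1) (0, 1) +
    .replicate (m - 1) (1, 0) + .replicate (m - 1) (1, 1), ?_, ?_⟩
  · simp only [Multiset.card_add, Multiset.card_replicate]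
    lia
  rintro ⟨T₀, hT₀, hs, hc⟩
  obtain ⟨T₁, hT₁, V, hV, rfl⟩ := split hT₀
  obtain ⟨T₂, hT₂, W, hW, rfl⟩ := split hT₁
  obtain ⟨T, hT, X, hX, rfl⟩ := split hT₂
  obtain ⟨v, hv, rfl⟩ := Multiset.le_replicate_iff.1 hV
  obtain ⟨w, hw, rfl⟩ := Multiset.le_replicate_iff.1 hW
  obtain ⟨x, hx, rfl⟩ := Multiset.le_replicate_iff.1 hX
  obtain ⟨t, ht, rfl⟩ := Multiset.le_replicate_iff.1 hT
  simp only [Multiset.sum_add, Multiset.sum_replicate, Prod.smul_mk, Prod.mk_add_mk, smul_zero,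
    nsmul_one, Prod.mk_eq_zero, zero_add, add_zero, ← Nat.cast_add, Multiset.card_add,
    Multiset.card_replicate, ZMod.natCast_eq_zero_iff] at hs hc
  obtain ⟨⟨i, hi⟩, ⟨j, hj⟩⟩ := hs
  have hi2 : i < 2 := by
    by_contra! h
    have := Nat.mul_le_mul_left m h
    lia
  have hj2 : j < 2 := by
    by_contra! h
    have := Nat.mul_le_mul_left (m * n) h
    lia
  interval_cases i <;> interval_cases j <;> lia

section Kemnitz

open Finset

variable {ι : Type*} [DecidableEq ι]

/-- Set functions of degree at most `d`, that is, combinations of the functions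
`T ↦ [U ⊆ T]` with `#U ≤ d`. -/
def setPoly (F ι : Type*) [Field F] [DecidableEq ι] (d : ℕ) : Submodule F (Finset ι → F) :=
  Submodule.span F (Set.image (fun U T => if U ⊆ T then 1 else 0) {U : Finset ι | #U ≤ d})

namespace setPoly

variable {F : Type*} [Field F]

theorem indicator_mem {d : ℕ} {U : Finset ι} (h : #U ≤ d) :
    (fun T => if U ⊆ T then 1 else 0) ∈ setPoly F ι d :=
  Submodule.subset_span ⟨U, h, rfl⟩

theorem mono {d e : ℕ} (h : d ≤ e) : setPoly F ι d ≤ setPoly F ι e :=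
  Submodule.span_mono (Set.image_mono fun _ hU => le_trans hU h)

theorem mul_mem {d e : ℕ} {f g : Finset ι → F} (hf : f ∈ setPoly F ι d)
    (hg : g ∈ setPoly F ι e) : f * g ∈ setPoly F ι (d + e) := by
  have h := Submodule.mul_mem_mul hf hg
  rw [setPoly, setPoly, Submodule.span_mul_span] at h
  refine Submodule.span_le.2 ?_ h
  rintro _ ⟨_, ⟨U, hU, rfl⟩, _, ⟨V, hV, rfl⟩, rfl⟩
  have hUV := indicator_mem (F := F) ((card_union_le U V).trans (add_le_add hU hV))
  refine (congrArg (· ∈ setPoly F ι (d + e)) (funext fun T => ?_)).mpr hUV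
  by_cases h1 : U ⊆ T <;> by_cases h2 : V ⊆ T <;> simp [h1, h2, union_subset_iff]

theorem one_mem (d : ℕ) : (1 : Finset ι → F) ∈ setPoly F ι d := by
  convert indicator_mem (F := F) (U := (∅ : Finset ι)) (Nat.zero_le d) using 1
  ext; simp

theorem pow_mem {f : Finset ι → F} (hf : f ∈ setPoly F ι 1) (k : ℕ) :
    f ^ k ∈ setPoly F ι k := by
  induction k with
  | zero => simpa using one_mem 0
  | succ k ih => rw [pow_succ]; exact mul_mem ih hf

theorem sum_mem [Fintype ι] (c : ι → F) : (fun T => ∑ i ∈ T, c i) ∈ setPoly F ι 1 := by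
  have : (fun T => ∑ i ∈ T, c i) =
      ∑ i, c i • fun T : Finset ι => if {i} ⊆ T then (1 : F) else 0 := by
    ext T
    simp [Finset.sum_apply]
  rw [this]
  exact Submodule.sum_mem _ fun i _ => Submodule.smul_mem _ _ (indicator_mem (by simp))

theorem choose_mem [Fintype ι] (d : ℕ) : (fun T => ((#T).choose d : F)) ∈ setPoly F ι d := by
  have : (fun T => ((#T).choose d : F)) =
      ∑ U ∈ powersetCard d univ, fun T : Finset ι => if U ⊆ T then (1 : F) else 0 := by
    ext T
    rw [Finset.sum_apply, sum_boole, ← card_powersetCard]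
    congr 2
    ext U
    simp [mem_powersetCard, and_comm]
  rw [this]
  exact Submodule.sum_mem _ fun U hU => indicator_mem (mem_powersetCard.1 hU).2.le

theorem alternating_sum_eq_zero {d : ℕ} {f : Finset ι → F} (hf : f ∈ setPoly F ι d)
    {X : Finset ι} (hX : d < #X) : ∑ T ∈ X.powerset, (-1) ^ #T * f T = 0 := by
  induction hf using Submodule.span_induction with
  | zero => simp
  | add f g _ _ hf hg => simp [mul_add, sum_add_distrib, hf, hg]
  | smul a f _ hf =>
    simp only [Pi.smul_apply, smul_eq_mul, mul_left_comm _ a, ← mul_sum, hf, mul_zero]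
  | mem f hf =>
    obtain ⟨U, hU, rfl⟩ := hf
    obtain ⟨x, hx, hxU⟩ := exists_mem_notMem_of_card_lt_card (lt_of_le_of_lt hU hX)
    rw [← insert_erase hx, sum_powerset_insert (notMem_erase x X), ← sum_add_distrib]
    refine sum_eq_zero fun T hT => ?_
    have hxT : x ∉ T := fun h => notMem_erase x X (mem_powerset.1 hT h)
    simp only [card_insert_of_notMem hxT, subset_insert_iff_of_notMem hxU, pow_succ]
    ring

end setPoly

variable {p : ℕ} [Fact p.Prime]

/-- Zero-sum index sets of cardinality `k` inside `X`. -/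
def zeroSumSets (f : ι → ZMod p × ZMod p) (k : ℕ) (X : Finset ι) : Finset (Finset ι) :=
  {T ∈ X.powersetCard k | ∑ i ∈ T, f i = 0}

variable {f : ι → ZMod p × ZMod p} {X : Finset ι}

omit [DecidableEq ι] in
theorem mem_zeroSumSets {k : ℕ} {T : Finset ι} :
    T ∈ zeroSumSets f k X ↔ T ⊆ X ∧ #T = k ∧ ∑ i ∈ T, f i = 0 := by
  simp [zeroSumSets, mem_powersetCard, and_assoc]

theorem zeroSum_indicator_mem [Fintype ι] (f : ι → ZMod p × ZMod p) :
    (fun T => if ∑ i ∈ T, f i = 0 then 1 else 0) ∈ setPoly (ZMod p) ι (2 * (p - 1)) := by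
  have key : ∀ c : ι → ZMod p, (1 - (fun T => ∑ i ∈ T, c i) ^ (p - 1)) ∈
      setPoly (ZMod p) ι (p - 1) :=
    fun c => Submodule.sub_mem _ (setPoly.one_mem _) (setPoly.pow_mem (setPoly.sum_mem c) _)
  have h := setPoly.mul_mem (key fun i => (f i).1) (key fun i => (f i).2)
  rw [← two_mul] at h
  convert h using 1
  have hp : p - 1 ≠ 0 := by have := (Fact.out : p.Prime).two_le; lia
  ext T
  simp only [Pi.mul_apply, Pi.sub_apply, Pi.one_apply, Pi.pow_apply, Prod.ext_iff, Prod.fst_sum,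
    Prod.snd_sum, Prod.fst_zero, Prod.snd_zero]
  by_cases h1 : ∑ i ∈ T, (f i).1 = 0 <;> by_cases h2 : ∑ i ∈ T, (f i).2 = 0 <;>
    simp [h1, h2, hp, ZMod.pow_card_sub_one_eq_one]

theorem sum_range_card_zeroSumSets_eq_zero [Fintype ι] {d : ℕ} {u : ℕ → ZMod p}
    (hu : (fun T => u #T) ∈ setPoly (ZMod p) ι d) (hd : d + 2 * (p - 1) < #X)
    (f : ι → ZMod p × ZMod p) {N : ℕ} (hN : #X < N) :
    ∑ k ∈ range N, (-1) ^ k * u k * (#(zeroSumSets f k X) : ZMod p) = 0 := by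
  rw [← setPoly.alternating_sum_eq_zero (setPoly.mul_mem hu (zeroSum_indicator_mem f)) hd,
    sum_powerset]
  rw [← sum_subset (range_subset_range.2 (Nat.succ_le_of_lt hN))]
  · refine sum_congr rfl fun k _ => ?_
    rw [zeroSumSets, ← sum_boole, mul_sum]
    refine sum_congr rfl fun T hT => ?_
    simp [(mem_powersetCard.1 hT).2]
  · intro k _ hk
    rw [zeroSumSets, powersetCard_eq_empty.2 (by simpa using hk)]
    simp

theorem sum_range_four_mul {M : Type*} [AddCommMonoid M] {p : ℕ} (hp : 2 ≤ p) (u : ℕ → M)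
    (hu : ∀ q r, 0 < r → r < p - 1 → u (p * q + r) = 0) :
    ∑ k ∈ range (4 * p), u k = ∑ q ∈ range 4, (u (p * q) + u (p * q + (p - 1))) := by
  have h : ∀ m, ∑ k ∈ range (m * p), u k = ∑ q ∈ range m, (u (p * q) + u (p * q + (p - 1))) := by
    intro m
    induction m with
    | zero => simp
    | succ m ih =>
      rw [add_mul, one_mul, sum_range_add, ih, sum_range_succ]
      congr 1
      obtain ⟨p, rfl⟩ := Nat.exists_eq_add_of_le hp
      rw [show 2 + p = p + 1 + 1 by ring, sum_range_succ, sum_range_succ', sum_eq_zero]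
      · simp [mul_comm]
      · intro i hi
        rw [← hu m (i + 1) (by lia) (by have := mem_range.1 hi; lia)]
        congr 1
        ring
  exact h 4

omit [DecidableEq ι] in
theorem card_zeroSumSets_zero : #(zeroSumSets f 0 X) = 1 := by
  simp [zeroSumSets, filter_singleton]

omit [DecidableEq ι] in
theorem card_zeroSumSets_of_lt {k : ℕ} (h : #X < k) : #(zeroSumSets f k X) = 0 := by
  simp [zeroSumSets, powersetCard_eq_empty.2 h]

theorem natCast_choose_prime (n : ℕ) : ((n.choose p : ℕ) : ZMod p) = (n / p : ℕ) := by
  have h := Choose.choose_modEq_choose_mod_mul_choose_div (n := n) (k := p) (p := p)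
  rw [← ZMod.intCast_eq_intCast_iff] at h
  simpa [-Int.natCast_ediv, Nat.div_self (Fact.out : p.Prime).pos] using h

theorem neg_one_pow_prime_mul (hp : p ≠ 2) (q r : ℕ) :
    (-1 : ZMod p) ^ (p * q + r) = (-1) ^ q * (-1) ^ r := by
  rw [pow_add, pow_mul, ((Fact.out : p.Prime).odd_of_ne_two hp).neg_one_pow]

theorem neg_one_pow_pred (hp : p ≠ 2) : (-1 : ZMod p) ^ (p - 1) = 1 :=
  (((Fact.out : p.Prime).even_sub_one hp)).neg_one_pow

theorem natCast_pred : ((p - 1 : ℕ) : ZMod p) = -1 := by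
  rw [Nat.cast_sub (Fact.out : p.Prime).one_le]; simp

theorem natCast_mul_pred (q : ℕ) [NeZero q] : ((q * p - 1 : ℕ) : ZMod p) = -1 := by
  rw [Nat.cast_sub (Nat.mul_pos (NeZero.pos q) (Fact.out : p.Prime).pos)]; simp

theorem natCast_ne {r : ℕ} (h0 : 0 < r) (hr : r < p - 1) :
    (r : ZMod p) ≠ 0 ∧ (r : ZMod p) + 1 ≠ 0 := by
  constructor
  · rw [Ne, ZMod.natCast_eq_zero_iff]
    exact Nat.not_dvd_of_pos_of_lt h0 (by lia)
  · have : ((r + 1 : ℕ) : ZMod p) ≠ 0 := by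
      rw [Ne, ZMod.natCast_eq_zero_iff]
      exact Nat.not_dvd_of_pos_of_lt (by lia) (by lia)
    exact_mod_cast this

theorem card_mem [Fintype ι] : (fun T => (#T : ZMod p)) ∈ setPoly (ZMod p) ι 1 := by
  simpa using setPoly.sum_mem (F := ZMod p) (fun _ : ι => 1)

/-- Alternating sums of zero-sum counts, weighted by a function of degree less than
`#X - 2 (p - 1)` that is supported on sizes congruent to `0` or `-1` modulo `p`. -/
theorem alternating_card_zeroSumSets [Fintype ι] (hp : p ≠ 2) (f : ι → ZMod p × ZMod p) {d : ℕ}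
    {u : ℕ → ZMod p} (hu : (fun T => u #T) ∈ setPoly (ZMod p) ι d) (hd : d + 2 * (p - 1) < #X)
    (hX : #X < 4 * p - 1)
    (hu₀ : ∀ k : ℕ, (k : ZMod p) ≠ 0 → (k : ZMod p) + 1 ≠ 0 → u k = 0) :
    u 0 - u p * #(zeroSumSets f p X) + u (2 * p) * #(zeroSumSets f (2 * p) X)
      - u (3 * p) * #(zeroSumSets f (3 * p) X) + u (p - 1) * #(zeroSumSets f (p - 1) X)
      - u (2 * p - 1) * #(zeroSumSets f (2 * p - 1) X)
      + u (3 * p - 1) * #(zeroSumSets f (3 * p - 1) X) = 0 := by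
  have h2 := (Fact.out : p.Prime).two_le
  have key := sum_range_card_zeroSumSets_eq_zero hu hd f (show #X < 4 * p by lia)
  rw [sum_range_four_mul h2] at key
  · simp only [sum_range_succ, range_zero, sum_empty, neg_one_pow_prime_mul hp,
      neg_one_pow_pred hp] at key
    have hpow : ∀ q, (-1 : ZMod p) ^ (p * q) = (-1) ^ q := fun q => by
      simpa using neg_one_pow_prime_mul hp q 0
    rw [hpow, hpow, hpow, hpow, show p * 3 + (p - 1) = 4 * p - 1 by lia,
      show p * 2 + (p - 1) = 3 * p - 1 by lia, show p * 1 + (p - 1) = 2 * p - 1 by lia,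
      show p * 0 + (p - 1) = p - 1 by lia, card_zeroSumSets_of_lt hX, mul_zero,
      card_zeroSumSets_zero, mul_comm p 2, mul_comm p 3, mul_one p] at key
    push_cast at key
    linear_combination key
  · intro q r h0 hr
    obtain ⟨h, h'⟩ := natCast_ne h0 hr
    rw [hu₀ (p * q + r) (by simpa using h) (by simpa using h')]
    simp

/-- The alternating count of zero-sum sets whose size is a multiple of `p`. -/
theorem card_zeroSumSets_mul [Fintype ι] (hp : p ≠ 2) (f : ι → ZMod p × ZMod p)
    (h₁ : 3 * (p - 1) < #X) (h₂ : #X < 4 * p - 1) :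
    1 - (#(zeroSumSets f p X) : ZMod p) + #(zeroSumSets f (2 * p) X)
      - #(zeroSumSets f (3 * p) X) = 0 := by
  have hp1 : p - 1 ≠ 0 := by have := (Fact.out : p.Prime).two_le; lia
  have hu : (fun T : Finset ι => 1 - (#T : ZMod p) ^ (p - 1)) ∈ setPoly (ZMod p) ι (p - 1) :=
    Submodule.sub_mem _ (setPoly.one_mem _) (setPoly.pow_mem card_mem _)
  have key := alternating_card_zeroSumSets (X := X) (u := fun k => 1 - (k : ZMod p) ^ (p - 1))
    hp f hu (by lia) h₂ fun k h _ => by simp [ZMod.pow_card_sub_one_eq_one h]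
  simpa [natCast_mul_pred, natCast_pred, neg_one_pow_pred hp, hp1] using key

/-- The alternating count of zero-sum sets whose size is `-1` modulo `p`. -/
theorem card_zeroSumSets_mul_sub_one [Fintype ι] (hp : p ≠ 2) (f : ι → ZMod p × ZMod p)
    (h₁ : #X = 4 * p - 3) :
    (#(zeroSumSets f (p - 1) X) : ZMod p) - #(zeroSumSets f (2 * p - 1) X)
      + #(zeroSumSets f (3 * p - 1) X) = 0 := by
  have h2 := (Fact.out : p.Prime).two_le
  have hp1 : p - 1 ≠ 0 := by lia
  have hu : (fun T : Finset ι => 1 - ((#T : ZMod p) + 1) ^ (p - 1)) ∈ setPoly (ZMod p) ι (p - 1) :=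
    Submodule.sub_mem _ (setPoly.one_mem _)
      (setPoly.pow_mem (Submodule.add_mem _ card_mem (setPoly.one_mem _)) _)
  have key := alternating_card_zeroSumSets (X := X) (u := fun k => 1 - ((k : ZMod p) + 1) ^ (p - 1))
    hp f hu (by lia) (by lia) fun k _ h => by simp [ZMod.pow_card_sub_one_eq_one h]
  simpa [natCast_mul_pred, natCast_pred, hp1] using key

theorem succ_pow_sub_pow_mem [Fintype ι] :
    (fun T : Finset ι => ((#T : ZMod p) + 1) ^ (p - 1) - (#T : ZMod p) ^ (p - 1)) ∈
      setPoly (ZMod p) ι (p - 2) := by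
  have h2 := (Fact.out : p.Prime).two_le
  have : (fun T : Finset ι => ((#T : ZMod p) + 1) ^ (p - 1) - (#T : ZMod p) ^ (p - 1)) =
      ∑ k ∈ range (p - 1), ((p - 1).choose k : ZMod p) • (fun T => (#T : ZMod p)) ^ k := by
    ext T
    rw [add_pow, sum_range_succ]
    simp [Finset.sum_apply, mul_comm]
  rw [this]
  refine Submodule.sum_mem _ fun k hk => Submodule.smul_mem _ _ ?_
  exact setPoly.mono (by have := mem_range.1 hk; lia) (setPoly.pow_mem card_mem k)

/-- The alternating count of zero-sum sets of size `0` or `-1` modulo `p`, weighted by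
`⌊size / p⌋`. -/
theorem card_zeroSumSets_weighted [Fintype ι] (hp : p ≠ 2) (f : ι → ZMod p × ZMod p)
    (h₁ : #X = 4 * p - 3) :
    -(#(zeroSumSets f p X) : ZMod p) + 2 * #(zeroSumSets f (2 * p) X)
      - 3 * #(zeroSumSets f (3 * p) X) + #(zeroSumSets f (2 * p - 1) X)
      - 2 * #(zeroSumSets f (3 * p - 1) X) = 0 := by
  have h2 := (Fact.out : p.Prime).two_le
  have hp1 : p - 1 ≠ 0 := by lia
  have key := alternating_card_zeroSumSets (X := X) (d := p - 2 + p)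
    (u := fun k => (((k : ZMod p) + 1) ^ (p - 1) - (k : ZMod p) ^ (p - 1)) *
      ((k.choose p : ℕ) : ZMod p)) hp f
    (setPoly.mul_mem succ_pow_sub_pow_mem (setPoly.choose_mem p)) (by lia) (by lia) fun k h h' => by
      simp [ZMod.pow_card_sub_one_eq_one h, ZMod.pow_card_sub_one_eq_one h']
  have d1 : (2 * p - 1) / p = 1 := Nat.div_eq_of_lt_le (by lia) (by lia)
  have d2 : (3 * p - 1) / p = 2 := Nat.div_eq_of_lt_le (by lia) (by lia)
  have d3 : (p - 1) / p = 0 := Nat.div_eq_of_lt (by lia)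
  simp only [natCast_choose_prime, d1, d2, d3, Nat.mul_div_cancel _ (show 0 < p by lia),
    Nat.div_self (show 0 < p by lia), Nat.zero_div] at key
  simp [natCast_mul_pred, natCast_pred, neg_one_pow_pred hp, hp1] at key
  linear_combination key

/-- A zero-sum family of size `3p` contains a zero-sum subfamily of size `p`. -/
theorem zeroSumSets_nonempty_of_three_mul [Fintype ι] (hp : p ≠ 2) (hX : #X = 3 * p)
    (hs : ∑ i ∈ X, f i = 0) : (zeroSumSets f p X).Nonempty := by
  have hpos := (Fact.out : p.Prime).pos
  obtain ⟨x, hx⟩ : X.Nonempty := card_pos.1 (by lia)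
  have hc : #(X.erase x) = 3 * p - 1 := by rw [card_erase_of_mem hx, hX]
  by_contra! hne
  have hne' : zeroSumSets f p (X.erase x) = ∅ := by
    refine eq_empty_of_forall_notMem fun T hT => ?_
    rw [mem_zeroSumSets] at hT
    exact notMem_empty T (hne ▸ mem_zeroSumSets.2 ⟨hT.1.trans (erase_subset _ _), hT.2⟩)
  have key := card_zeroSumSets_mul (X := X.erase x) hp f (by lia) (by lia)
  rw [hne', card_zeroSumSets_of_lt (show #(X.erase x) < 3 * p by lia)] at key
  have : zeroSumSets f (2 * p) (X.erase x) ≠ ∅ := by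
    intro h
    simp [h] at key
  obtain ⟨T, hT⟩ := nonempty_iff_ne_empty.2 this
  obtain ⟨hTX, hTc, hTs⟩ := mem_zeroSumSets.1 hT
  have hTX := hTX.trans (erase_subset x X)
  refine notMem_empty (X \ T) (hne ▸ mem_zeroSumSets.2 ⟨sdiff_subset, ?_, ?_⟩)
  · rw [card_sdiff_of_subset hTX]; lia
  · rw [← sum_sdiff hTX, hTs, add_zero] at hs
    exact hs

/-- Double counting of pairs of disjoint zero-sum sets of sizes `a` and `b`. -/
theorem sum_card_zeroSumSets_sdiff (f : ι → ZMod p × ZMod p) (X : Finset ι) (a b : ℕ) :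
    ∑ A ∈ zeroSumSets f a X, #(zeroSumSets f b (X \ A)) =
      ∑ D ∈ zeroSumSets f (a + b) X, #(zeroSumSets f b D) := by
  rw [← card_sigma, ← card_sigma]
  refine card_nbij' (fun z => ⟨z.1 ∪ z.2, z.2⟩) (fun z => ⟨z.1 \ z.2, z.2⟩) ?_ ?_ ?_ ?_
  · rintro ⟨A, C⟩ h
    simp only [coe_sigma, Set.mem_sigma_iff, mem_coe, mem_zeroSumSets, subset_sdiff] at h ⊢
    obtain ⟨⟨hA, hAc, hAs⟩, ⟨hC, hd⟩, hCc, hCs⟩ := h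
    exact ⟨⟨union_subset hA hC, by rw [card_union_of_disjoint hd.symm, hAc, hCc],
      by rw [sum_union hd.symm, hAs, hCs, add_zero]⟩, subset_union_right, hCc, hCs⟩
  · rintro ⟨D, C⟩ h
    simp only [coe_sigma, Set.mem_sigma_iff, mem_coe, mem_zeroSumSets, subset_sdiff] at h ⊢
    obtain ⟨⟨hD, hDc, hDs⟩, hC, hCc, hCs⟩ := h
    refine ⟨⟨sdiff_subset.trans hD, ?_, ?_⟩, ⟨hC.trans hD, disjoint_sdiff⟩, hCc, hCs⟩
    · rw [card_sdiff_of_subset hC]; lia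
    · rwa [← sum_sdiff hC, hCs, add_zero] at hDs
  · rintro ⟨A, C⟩ h
    simp only [coe_sigma, Set.mem_sigma_iff, mem_coe, mem_zeroSumSets, subset_sdiff] at h
    simp [union_sdiff_cancel_right h.2.1.2.symm]
  · rintro ⟨D, C⟩ h
    simp only [coe_sigma, Set.mem_sigma_iff, mem_coe, mem_zeroSumSets] at h
    simp [sdiff_union_of_subset h.2.1]

/-- **Reiher's theorem**: `4p - 3` elements of `C_p ⊕ C_p` contain `p` with zero sum. -/
theorem zeroSumSets_nonempty [Fintype ι] (hp : p ≠ 2) (f : ι → ZMod p × ZMod p)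
    (hX : #X = 4 * p - 3) : (zeroSumSets f p X).Nonempty := by
  have h2 := (Fact.out : p.Prime).two_le
  have h3 : 3 ≤ p := by lia
  by_contra! hne
  have hsub : ∀ Y ⊆ X, zeroSumSets f p Y = ∅ := fun Y hY => by
    refine eq_empty_of_forall_notMem fun T hT => ?_
    rw [mem_zeroSumSets] at hT
    exact notMem_empty T (hne ▸ mem_zeroSumSets.2 ⟨hT.1.trans hY, hT.2⟩)
  have h3p : zeroSumSets f (3 * p) X = ∅ := by
    refine eq_empty_of_forall_notMem fun T hT => ?_
    obtain ⟨hTX, hTc, hTs⟩ := mem_zeroSumSets.1 hT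
    have := zeroSumSets_nonempty_of_three_mul hp hTc hTs
    rw [hsub T hTX] at this
    exact not_nonempty_empty this
  have hcount : ∀ Y ⊆ X, 3 * p - 2 ≤ #Y → #Y < 3 * p →
      (#(zeroSumSets f (2 * p) Y) : ZMod p) = -1 := fun Y hY h h' => by
    have key := card_zeroSumSets_mul (X := Y) hp f (by lia) (by lia)
    rw [hsub Y hY, card_zeroSumSets_of_lt h'] at key
    simp only [card_empty, Nat.cast_zero] at key
    linear_combination key
  have hsym : (#(zeroSumSets f (p - 1) X) : ZMod p) = #(zeroSumSets f (3 * p - 1) X) := by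
    have h := congrArg (Nat.cast : ℕ → ZMod p) (sum_card_zeroSumSets_sdiff f X (p - 1) (2 * p))
    rw [Nat.cast_sum, Nat.cast_sum, sum_congr rfl (g := fun _ => (-1 : ZMod p)),
      sum_congr (s₁ := zeroSumSets f (p - 1 + 2 * p) X) rfl (g := fun _ => (-1 : ZMod p)),
      show p - 1 + 2 * p = 3 * p - 1 by lia] at h
    · simpa using h
    · intro D hD
      obtain ⟨hDX, hDc, -⟩ := mem_zeroSumSets.1 hD
      exact hcount D hDX (by lia) (by lia)
    · intro A hA
      obtain ⟨hAX, hAc, -⟩ := mem_zeroSumSets.1 hA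
      have : #(X \ A) = 3 * p - 2 := by rw [card_sdiff_of_subset hAX]; lia
      exact hcount _ sdiff_subset (by lia) (by lia)
  have e1 := card_zeroSumSets_mul (X := X) hp f (by lia) (by lia)
  have e2 := card_zeroSumSets_mul_sub_one hp f hX
  have e3 := card_zeroSumSets_weighted hp f hX
  rw [h3p, hne] at e1 e3
  simp only [card_empty, Nat.cast_zero] at e1 e3
  have h : (2 : ZMod p) = 0 := by linear_combination 2 * e1 - e3 - e2 + hsym
  have h' : ((2 : ℕ) : ZMod p) = 0 := by exact_mod_cast h
  rw [ZMod.natCast_eq_zero_iff] at h'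
  exact hp (le_antisymm (Nat.le_of_dvd two_pos h') h2)

end Kemnitz

theorem forcesZeroSum_two : ForcesZeroSum (ZMod 2 × ZMod 2) 2 5 := by
  intro S hS
  by_cases h : S.Nodup
  · have h1 := Finset.card_le_univ S.toFinset
    rw [Multiset.toFinset_card_of_nodup h] at h1
    have h2 : Fintype.card (ZMod 2 × ZMod 2) = 4 := by decide
    lia
  · rw [Multiset.nodup_iff_le] at h
    push Not at h
    obtain ⟨x, hx⟩ := h
    have h2 : ∀ y : ZMod 2 × ZMod 2, (y ::ₘ y ::ₘ 0).sum = 0 := by decide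
    exact ⟨_, hx, h2 x, rfl⟩

theorem forcesZeroSum_prime {p : ℕ} (hp : p.Prime) :
    ForcesZeroSum (ZMod p × ZMod p) p (4 * p - 3) := by
  rcases eq_or_ne p 2 with rfl | hp2
  · exact forcesZeroSum_two
  have : Fact p.Prime := ⟨hp⟩
  classical
  intro S hS
  obtain ⟨X, -, hX⟩ := Finset.exists_subset_card_eq
    (show 4 * p - 3 ≤ (Finset.univ : Finset S).card by simpa using hS)
  obtain ⟨T, hT⟩ := zeroSumSets_nonempty hp2 (fun x : S => x.1) hX
  obtain ⟨-, hTc, hTs⟩ := mem_zeroSumSets.1 hT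
  refine ⟨T.val.map fun x : S => x.1, ?_, hTs, by simpa using hTc⟩
  calc T.val.map (fun x => x.1) ≤ Finset.univ.val.map (fun x : S => x.1) :=
        Multiset.map_le_map (Finset.val_le_iff.2 (Finset.subset_univ T))
    _ = S := Multiset.map_univ_coe S

/-- The Kemnitz conjecture for arbitrary moduli. -/
theorem forcesZeroSum_square {m : ℕ} (hm : 0 < m) :
    ForcesZeroSum (ZMod m × ZMod m) m (4 * m - 3) := by
  induction m using Nat.recOnMul with
  | zero => exact absurd hm (lt_irrefl 0)
  | one =>
    intro S hS
    obtain ⟨x, hx⟩ := Multiset.card_pos_iff_exists_mem.1 (show 0 < S.card by lia)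
    exact ⟨{x}, Multiset.singleton_le.2 hx, Subsingleton.elim _ _, rfl⟩
  | prime p hp => exact forcesZeroSum_prime hp
  | mul a b iha ihb =>
    exact .square_mul (Nat.pos_of_ne_zero (by rintro rfl; simp at hm))
      (iha (Nat.pos_of_ne_zero (by rintro rfl; simp at hm)))
      (ihb (Nat.pos_of_ne_zero (by rintro rfl; simp at hm)))


/-- For `G = C_m ⊕ C_{mn}`, `s(G) = 2m + 2mn - 3`: every sequence of length
at least `2m + 2mn - 3` has a zero-sum subsequence of length exactly `mn = exp(G)`, and
there is a sequence of length `2m + 2mn - 4` with none. -/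
theorem stmt_12 (m n : ℕ) (hm : 0 < m) (hn : 0 < n) :
    (∀ S : Multiset (ZMod m × ZMod (m * n)), 2 * m + 2 * (m * n) - 3 ≤ S.card →
      ∃ T ≤ S, T.sum = 0 ∧ Multiset.card T = m * n) ∧
    (∃ S : Multiset (ZMod m × ZMod (m * n)), S.card = 2 * m + 2 * (m * n) - 4 ∧
      ¬ ∃ T ≤ S, T.sum = 0 ∧ Multiset.card T = m * n) :=
  ⟨ForcesZeroSum.prod_mul hn (forcesZeroSum_square hm), exists_no_zeroSum m n hm hn⟩
end
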